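/- If f is a q-function with L f = 0 identically, then f is 0-homogeneous. -/

import Mathlib

noncomputable section

/-- The type of candidate local functions: functions of `x` and the jet `(q₀, q₁, …)`. -/
abbrev QFun := ℝ → (ℕ → ℝ) → ℝ

/-- `IsQFunc X m f` : `f` is a q-function of order `m` on `X`: it depends only on
`x, q_0, …, q_m` and is infinitely differentiable for `x ∈ X`, `q_0 > 0`. -/
def IsQFunc (X : Set ℝ) (m : ℕ) (f : QFun) : Prop :=
  ∃ F : ℝ × (Fin (m + 1) → ℝ) → ℝ,
    ContDiffOn ℝ (⊤ : ℕ∞) F {p : ℝ × (Fin (m + 1) → ℝ) | p.1 ∈ X ∧ 0 < p.2 0} ∧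
    ∀ x q, f x q = F (x, fun i => q i.val)

/-- Partial derivative with respect to `x`. -/
def pdx (f : QFun) : QFun := fun x q => deriv (fun t => f t q) x

/-- Partial derivative with respect to `q_j`. -/
def pd (j : ℕ) (f : QFun) : QFun :=
  fun x q => deriv (fun t => f x (Function.update q j t)) (q j)

/-- The total-derivative operator `D f = ∂f/∂x + Σ_j q_{j+1} ∂f/∂q_j`. -/
def Dop (f : QFun) : QFun :=
  fun x q => pdx f x q + ∑' j : ℕ, q (j + 1) * pd j f x q

/-- The Lagrange operator `Λ f = Σ_k (-1)^k D^k (∂f/∂q_k)`. -/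
def Lam (f : QFun) : QFun :=
  fun x q => ∑' k : ℕ, (-1 : ℝ) ^ k * Dop^[k] (pd k f) x q

/-- The operator `L f = Σ_k (-1)^(k+1) D^k (q_0 ∂f/∂q_k)`. -/
def Lop (f : QFun) : QFun :=
  fun x q => ∑' k : ℕ, (-1 : ℝ) ^ (k + 1) * Dop^[k] (fun y p => p 0 * pd k f y p) x q

/-- The Euler operator `E f = Σ_j q_j ∂f/∂q_j`. -/
def Eop (f : QFun) : QFun := fun x q => ∑' j : ℕ, q j * pd j f x q

/-- The operator `B_r f = Σ_{k ≥ r+1} (-1)^(k-1-r) D^(k-1-r) (∂f/∂q_k)`, for `r ≥ -1`. -/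
def Bop (r : ℤ) (f : QFun) : QFun :=
  fun x q => ∑' k : ℕ,
    if r + 1 ≤ (k : ℤ) then
      (-1 : ℝ) ^ ((k : ℤ) - 1 - r).toNat * Dop^[((k : ℤ) - 1 - r).toNat] (pd k f) x q
    else 0

/-- The operator `C f = Σ_{r ≥ 0} q_r B_r f`. -/
def Cop (f : QFun) : QFun := fun x q => ∑' r : ℕ, q r * Bop (r : ℤ) f x q

/-- `f` is homogeneous of degree `h` in `(q_0, q_1, …)`. -/
def IsHomog (X : Set ℝ) (h : ℝ) (f : QFun) : Prop :=
  ∀ x ∈ X, ∀ q : ℕ → ℝ, 0 < q 0 → ∀ l : ℝ, 0 < l →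
    f x (fun j => l * q j) = l ^ h * f x q

/-- `X` is a nonempty open (possibly infinite or semi-infinite) interval of `ℝ`. -/
def IsOpenInterval (X : Set ℝ) : Prop := IsOpen X ∧ X.OrdConnected ∧ X.Nonempty

open Set Filter Topology

/-- The domain on which q-functions of order `N` are smooth. -/
def jetDomain (X : Set ℝ) (N : ℕ) : Set (ℝ × (Fin (N + 1) → ℝ)) :=
  {p | p.1 ∈ X ∧ 0 < p.2 0}

/-- The first `N + 1` entries of a sequence. -/
def jetRestrict (N : ℕ) (q : ℕ → ℝ) : Fin (N + 1) → ℝ := fun i => q i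

/-- The `N`-jet of a function of one variable. -/
def jet (N : ℕ) (u : ℝ → ℝ) (x : ℝ) : Fin (N + 1) → ℝ := fun i => iteratedDeriv i u x

/-- The smooth function `F` of finitely many variables agrees with `g` on the jet domain. -/
def Represents (X : Set ℝ) (N : ℕ) (g : QFun) (F : ℝ × (Fin (N + 1) → ℝ) → ℝ) : Prop :=
  ContDiffOn ℝ (⊤ : ℕ∞) F (jetDomain X N) ∧
    ∀ x ∈ X, ∀ q : ℕ → ℝ, 0 < q 0 → g x q = F (x, jetRestrict N q)

lemma isOpen_jetDomain {X : Set ℝ} (hX : IsOpen X) (N : ℕ) : IsOpen (jetDomain X N) :=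
  (hX.preimage continuous_fst).inter
    (isOpen_lt continuous_const ((continuous_apply 0).comp continuous_snd))

namespace Represents

variable {X : Set ℝ} {N : ℕ} {g : QFun} {F : ℝ × (Fin (N + 1) → ℝ) → ℝ}

lemma contDiffAt (h : Represents X N g F) (hX : IsOpen X) {p : ℝ × (Fin (N + 1) → ℝ)}
    (hp : p ∈ jetDomain X N) : ContDiffAt ℝ (⊤ : ℕ∞) F p :=
  h.1.contDiffAt ((isOpen_jetDomain hX N).mem_nhds hp)

lemma hasFDerivAt (h : Represents X N g F) (hX : IsOpen X) {p : ℝ × (Fin (N + 1) → ℝ)}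
    (hp : p ∈ jetDomain X N) : HasFDerivAt F (fderiv ℝ F p) p :=
  ((h.contDiffAt hX hp).differentiableAt (by simp)).hasFDerivAt

lemma contDiffOn_fderiv (h : Represents X N g F) (hX : IsOpen X) :
    ContDiffOn ℝ (⊤ : ℕ∞) (fderiv ℝ F) (jetDomain X N) :=
  h.1.fderiv_of_isOpen (isOpen_jetDomain hX N) (by simp)

lemma pdx_eq (h : Represents X N g F) (hX : IsOpen X) {x : ℝ} (hx : x ∈ X) {q : ℕ → ℝ}
    (hq : 0 < q 0) : pdx g x q = fderiv ℝ F (x, jetRestrict N q) (1, 0) := by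
  have h1 : (fun t => g t q) =ᶠ[𝓝 x] fun t => F (t, jetRestrict N q) := by
    filter_upwards [hX.mem_nhds hx] with t ht using h.2 t ht q hq
  have h2 : HasDerivAt (fun t => F (t, jetRestrict N q))
      (fderiv ℝ F (x, jetRestrict N q) (1, 0)) x :=
    (h.hasFDerivAt hX (p := (x, jetRestrict N q)) ⟨hx, hq⟩).comp_hasDerivAt x
      ((hasDerivAt_id x).prodMk (hasDerivAt_const x _))
  exact h1.deriv_eq.trans h2.deriv

lemma pd_eq (h : Represents X N g F) (hX : IsOpen X) {x : ℝ} (hx : x ∈ X) {q : ℕ → ℝ}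
    (hq : 0 < q 0) (j : ℕ) : pd j g x q =
      fderiv ℝ F (x, jetRestrict N q) (0, fun i => if (i : ℕ) = j then 1 else 0) := by
  have hself : jetRestrict N (Function.update q j (q j)) = jetRestrict N q := by simp
  have hcont : ContinuousAt (fun t => Function.update q j t 0) (q j) := by
    have : Continuous fun t => Function.update q j t :=
      continuous_const.update j continuous_id
    exact ((continuous_apply 0).comp this).continuousAt
  have h1 : (fun t => g x (Function.update q j t)) =ᶠ[𝓝 (q j)]
      fun t => F (x, jetRestrict N (Function.update q j t)) := by
    filter_upwards [hcont.eventually (lt_mem_nhds (by simpa using hq))] with t ht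
      using h.2 x hx _ ht
  have h3 : HasDerivAt (fun t => jetRestrict N (Function.update q j t))
      (fun i => if (i : ℕ) = j then 1 else 0) (q j) := by
    rw [hasDerivAt_pi]
    intro i
    by_cases hi : (i : ℕ) = j
    · simpa [jetRestrict, hi] using! hasDerivAt_id' (q j)
    · simpa [jetRestrict, hi] using hasDerivAt_const (q j) (q i)
  have h2 : HasDerivAt (fun t => F (x, jetRestrict N (Function.update q j t)))
      (fderiv ℝ F (x, jetRestrict N q) (0, fun i => if (i : ℕ) = j then 1 else 0)) (q j) := by
    have hF := h.hasFDerivAt hX (p := (x, jetRestrict N q)) ⟨hx, hq⟩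
    rw [← hself] at hF
    have := hF.comp_hasDerivAt (q j) ((hasDerivAt_const (q j) x).prodMk h3)
    rwa [hself] at this
  exact h1.deriv_eq.trans h2.deriv

lemma pd_eq_zero (h : Represents X N g F) (hX : IsOpen X) {x : ℝ} (hx : x ∈ X) {q : ℕ → ℝ}
    (hq : 0 < q 0) {j : ℕ} (hj : N < j) : pd j g x q = 0 := by
  have : (fun i : Fin (N + 1) => if (i : ℕ) = j then (1 : ℝ) else 0) = 0 := by
    funext i
    simp [show (i : ℕ) ≠ j by omega]
  rw [h.pd_eq hX hx hq, this]
  exact map_zero _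

lemma sum_mul_pd (h : Represents X N g F) (hX : IsOpen X) {x : ℝ} (hx : x ∈ X) {q : ℕ → ℝ}
    (hq : 0 < q 0) (c : ℕ → ℝ) : ∑ j ∈ Finset.range (N + 1), c j * pd j g x q =
      fderiv ℝ F (x, jetRestrict N q) (0, jetRestrict N c) := by
  have : ((0, jetRestrict N c) : ℝ × (Fin (N + 1) → ℝ)) =
      ∑ j ∈ Finset.range (N + 1), c j • (0, fun i : Fin (N + 1) => if (i : ℕ) = j then 1 else 0) := by
    ext i
    · simp [Prod.fst_sum]
    · simp [Prod.snd_sum, jetRestrict, Finset.sum_apply, i.2]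
  rw [this, map_sum]
  refine Finset.sum_congr rfl fun j _ => ?_
  rw [map_smul, smul_eq_mul, h.pd_eq hX hx hq]

lemma Dop_eq (h : Represents X N g F) (hX : IsOpen X) {x : ℝ} (hx : x ∈ X) {q : ℕ → ℝ}
    (hq : 0 < q 0) : Dop g x q =
      fderiv ℝ F (x, jetRestrict N q) (1, jetRestrict N fun j => q (j + 1)) := by
  rw [Dop, tsum_eq_sum (s := Finset.range (N + 1)), h.pdx_eq hX hx hq,
    h.sum_mul_pd hX hx hq fun j => q (j + 1), ← map_add]
  · simp
  · intro j hj
    rw [h.pd_eq_zero hX hx hq (by simpa [Nat.lt_succ_iff] using hj), mul_zero]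

lemma dop (h : Represents X N g F) (hX : IsOpen X) :
    Represents X (N + 1) (Dop g) fun p =>
      fderiv ℝ F (p.1, fun i => p.2 i.castSucc) (1, fun i => p.2 i.succ) := by
  constructor
  · refine ((h.contDiffOn_fderiv hX).comp (t := jetDomain X N)
      (f := fun p : ℝ × (Fin (N + 1 + 1) → ℝ) => (p.1, fun i : Fin (N + 1) => p.2 i.castSucc))
      ?_ ?_).clm_apply ?_
    · fun_prop
    · intro p hp
      exact hp
    · fun_prop
  · intro x hx q hq
    rw [h.Dop_eq hX hx hq]
    rfl

lemma mul_pd (h : Represents X N g F) (hX : IsOpen X) (k : ℕ) :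
    Represents X N (fun y p => p 0 * pd k g y p) fun p =>
      p.2 0 * fderiv ℝ F p (0, fun i => if (i : ℕ) = k then 1 else 0) := by
  constructor
  · refine ContDiffOn.mul (by fun_prop) ((h.contDiffOn_fderiv hX).clm_apply contDiffOn_const)
  · intro x hx q hq
    simp only [h.pd_eq hX hx hq]
    rfl

end Represents

lemma iterate_Dop_eq_zero {X : Set ℝ} (hX : IsOpen X) {g : QFun}
    (hg : ∀ x ∈ X, ∀ q : ℕ → ℝ, 0 < q 0 → g x q = 0) (k : ℕ) :
    ∀ x ∈ X, ∀ q : ℕ → ℝ, 0 < q 0 → Dop^[k] g x q = 0 := by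
  induction k generalizing g with
  | zero => exact hg
  | succ k ih =>
    refine ih fun x hx q hq => ?_
    have : Represents X 0 g 0 := ⟨contDiffOn_const, hg⟩
    rw [this.Dop_eq hX hx hq]
    simp

lemma Represents.Lop_eq {X : Set ℝ} {N : ℕ} {g : QFun} {F : ℝ × (Fin (N + 1) → ℝ) → ℝ}
    (h : Represents X N g F) (hX : IsOpen X) {x : ℝ} (hx : x ∈ X) {q : ℕ → ℝ}
    (hq : 0 < q 0) : Lop g x q = ∑ k ∈ Finset.range (N + 1),
      (-1 : ℝ) ^ (k + 1) * Dop^[k] (fun y p => p 0 * pd k g y p) x q := by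
  rw [Lop, tsum_eq_sum]
  intro k hk
  rw [iterate_Dop_eq_zero hX _ k x hx q hq, mul_zero]
  intro y hy p hp
  simp only [h.pd_eq_zero hX hy hp (by simpa [Nat.lt_succ_iff] using hk), mul_zero]

lemma hasDerivAt_iteratedDeriv {u : ℝ → ℝ} (hu : ContDiff ℝ (⊤ : ℕ∞) u) (k : ℕ) (x : ℝ) :
    HasDerivAt (iteratedDeriv k u) (iteratedDeriv (k + 1) u x) x := by
  rw [iteratedDeriv_succ]
  exact (hu.differentiable_iteratedDeriv k (by exact_mod_cast ENat.natCast_lt_top k) x).hasDerivAt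

lemma continuous_iteratedDeriv_of_smooth {u : ℝ → ℝ} (hu : ContDiff ℝ (⊤ : ℕ∞) u) (k : ℕ) :
    Continuous (iteratedDeriv k u) :=
  hu.continuous_iteratedDeriv k (by exact_mod_cast le_top)

lemma continuous_jet {u : ℝ → ℝ} (hu : ContDiff ℝ (⊤ : ℕ∞) u) (N : ℕ) : Continuous (jet N u) :=
  continuous_pi fun i => continuous_iteratedDeriv_of_smooth hu i

/-- The chain rule: `D` is the total derivative along jets of functions. -/
lemma Represents.hasDerivAt_jet {X : Set ℝ} {N : ℕ} {g : QFun} {F : ℝ × (Fin (N + 1) → ℝ) → ℝ}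
    (h : Represents X N g F) (hX : IsOpen X) {u : ℝ → ℝ} (hu : ContDiff ℝ (⊤ : ℕ∞) u)
    {x : ℝ} (hx : x ∈ X) (hux : 0 < u x) :
    HasDerivAt (fun y => g y fun j => iteratedDeriv j u y)
      (Dop g x fun j => iteratedDeriv j u x) x := by
  have hux' : 0 < iteratedDeriv 0 u x := by simpa using hux
  have h1 : (fun y => g y fun j => iteratedDeriv j u y) =ᶠ[𝓝 x] fun y => F (y, jet N u y) := by
    filter_upwards [hX.mem_nhds hx, hu.continuous.continuousAt.eventually (lt_mem_nhds hux)]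
      with y hy huy
    exact h.2 y hy _ (by simpa using huy)
  have h2 : HasDerivAt (jet N u) (jetRestrict N fun j => iteratedDeriv (j + 1) u x) x :=
    hasDerivAt_pi.2 fun i => hasDerivAt_iteratedDeriv hu i x
  rw [h.Dop_eq hX hx hux']
  exact HasDerivAt.congr_of_eventuallyEq ((h.hasFDerivAt hX (p := (x, jet N u x))
    ⟨hx, hux'⟩).comp_hasDerivAt x ((hasDerivAt_id x).prodMk h2)) h1

lemma Represents.continuousOn_jet {X : Set ℝ} {N : ℕ} {g : QFun}
    {F : ℝ × (Fin (N + 1) → ℝ) → ℝ} (h : Represents X N g F) (hX : IsOpen X) {u : ℝ → ℝ}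
    (hu : ContDiff ℝ (⊤ : ℕ∞) u) {a b : ℝ} (hab : Icc a b ⊆ X) (hpos : ∀ x ∈ Icc a b, 0 < u x) :
    ContinuousOn (fun y => g y fun j => iteratedDeriv j u y) (Icc a b) := fun x hx =>
  (h.hasDerivAt_jet hX hu (hab hx) (hpos x hx)).continuousAt.continuousWithinAt

/-- Repeated integration by parts along the jet of a function. -/
lemma Represents.integral_mul_iteratedDeriv {X : Set ℝ} (hX : IsOpen X) {u φ : ℝ → ℝ}
    (hu : ContDiff ℝ (⊤ : ℕ∞) u) (hφ : ContDiff ℝ (⊤ : ℕ∞) φ) {a b : ℝ} (hle : a ≤ b)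
    (hab : Icc a b ⊆ X) (hpos : ∀ x ∈ Icc a b, 0 < u x)
    (hφa : ∀ k, iteratedDeriv k φ a = 0) (hφb : ∀ k, iteratedDeriv k φ b = 0) (k : ℕ) :
    ∀ {N : ℕ} {g : QFun} {F : ℝ × (Fin (N + 1) → ℝ) → ℝ}, Represents X N g F →
    ∫ x in a..b, g x (fun j => iteratedDeriv j u x) * iteratedDeriv k φ x =
      (-1) ^ k * ∫ x in a..b, Dop^[k] g x (fun j => iteratedDeriv j u x) * φ x := by
  induction k with
  | zero => intros; simp
  | succ k ih =>
    intro N g F h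
    rw [intervalIntegral.integral_mul_deriv_eq_deriv_mul
      (u' := fun x => Dop g x fun j => iteratedDeriv j u x) (v := iteratedDeriv k φ),
      hφa, hφb, ih (h.dop hX), Function.iterate_succ_apply]
    · ring
    · rw [uIcc_of_le hle]
      exact fun x hx => h.hasDerivAt_jet hX hu (hab hx) (hpos x hx)
    · exact fun x _ => hasDerivAt_iteratedDeriv hφ k x
    · apply ContinuousOn.intervalIntegrable
      rw [uIcc_of_le hle]
      exact (h.dop hX).continuousOn_jet hX hu hab hpos
    · exact (continuous_iteratedDeriv_of_smooth hφ _).intervalIntegrable _ _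

/-- If `L g = 0`, the variation of `g` in a compactly supported direction, weighted by the
base function, integrates to zero. -/
lemma Represents.integral_mul_fderiv_eq_zero {X : Set ℝ} (hX : IsOpen X) {N : ℕ} {g : QFun}
    {F : ℝ × (Fin (N + 1) → ℝ) → ℝ} (h : Represents X N g F)
    (hL : ∀ x ∈ X, ∀ q : ℕ → ℝ, 0 < q 0 → Lop g x q = 0) {u φ : ℝ → ℝ}
    (hu : ContDiff ℝ (⊤ : ℕ∞) u) (hφ : ContDiff ℝ (⊤ : ℕ∞) φ) {a b : ℝ} (hle : a ≤ b)
    (hab : Icc a b ⊆ X) (hpos : ∀ x ∈ Icc a b, 0 < u x)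
    (hφa : ∀ k, iteratedDeriv k φ a = 0) (hφb : ∀ k, iteratedDeriv k φ b = 0) :
    ∫ x in a..b, u x * fderiv ℝ F (x, jet N u x) (0, jet N φ x) = 0 := by
  have hrep := fun k => h.mul_pd hX k
  have hDrep : ∀ k, ContinuousOn (fun x => Dop^[k] (fun y p => p 0 * pd k g y p) x
      fun j => iteratedDeriv j u x) (Icc a b) := by
    have key : ∀ k, ∀ {M : ℕ} {f : QFun} {G : ℝ × (Fin (M + 1) → ℝ) → ℝ}, Represents X M f G →
        ContinuousOn (fun x => Dop^[k] f x fun j => iteratedDeriv j u x) (Icc a b) := by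
      intro k
      induction k with
      | zero => intro M f G hf; exact hf.continuousOn_jet hX hu hab hpos
      | succ k ih => intro M f G hf; exact ih (hf.dop hX)
    exact fun k => key k (hrep k)
  have hint1 : ∀ k, IntervalIntegrable (fun x => (u x * pd k g x fun j => iteratedDeriv j u x) *
      iteratedDeriv k φ x) MeasureTheory.volume a b := by
    intro k
    apply ContinuousOn.intervalIntegrable
    rw [uIcc_of_le hle]
    have := (hrep k).continuousOn_jet hX hu hab hpos
    simp only [iteratedDeriv_zero] at this
    exact this.mul (continuous_iteratedDeriv_of_smooth hφ _).continuousOn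
  have hint2 : ∀ k, IntervalIntegrable (fun x => (-1 : ℝ) ^ k *
      (Dop^[k] (fun y p => p 0 * pd k g y p) x (fun j => iteratedDeriv j u x) * φ x))
      MeasureTheory.volume a b := by
    intro k
    apply ContinuousOn.intervalIntegrable
    rw [uIcc_of_le hle]
    exact continuousOn_const.mul ((hDrep k).mul hφ.continuous.continuousOn)
  calc ∫ x in a..b, u x * fderiv ℝ F (x, jet N u x) (0, jet N φ x)
      = ∫ x in a..b, ∑ k ∈ Finset.range (N + 1),
          (u x * pd k g x fun j => iteratedDeriv j u x) * iteratedDeriv k φ x := by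
        refine intervalIntegral.integral_congr fun x hx => ?_
        rw [uIcc_of_le hle] at hx
        have := h.sum_mul_pd hX (hab hx) (q := fun j => iteratedDeriv j u x)
          (by simpa using hpos x hx) fun j => iteratedDeriv j φ x
        change u x * fderiv ℝ F (x, jetRestrict N fun j => iteratedDeriv j u x)
          (0, jetRestrict N fun j => iteratedDeriv j φ x) = _
        rw [← this, Finset.mul_sum]
        exact Finset.sum_congr rfl fun k _ => by ring
    _ = ∫ x in a..b, ∑ k ∈ Finset.range (N + 1), (-1 : ℝ) ^ k *
          (Dop^[k] (fun y p => p 0 * pd k g y p) x (fun j => iteratedDeriv j u x) * φ x) := by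
        rw [intervalIntegral.integral_finsetSum fun k _ => hint1 k,
          intervalIntegral.integral_finsetSum fun k _ => hint2 k]
        refine Finset.sum_congr rfl fun k _ => ?_
        have := Represents.integral_mul_iteratedDeriv hX hu hφ hle hab hpos hφa hφb k (hrep k)
        simp only [iteratedDeriv_zero] at this
        rw [this, intervalIntegral.integral_const_mul]
    _ = ∫ x in a..b, 0 := by
        refine intervalIntegral.integral_congr fun x hx => ?_
        rw [uIcc_of_le hle] at hx
        have hq : 0 < iteratedDeriv 0 u x := by simpa using hpos x hx
        have := hL x (hab hx) (fun j => iteratedDeriv j u x) hq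
        rw [h.Lop_eq hX (hab hx) hq] at this
        have h2 : (∑ k ∈ Finset.range (N + 1), (-1 : ℝ) ^ k *
          (Dop^[k] (fun y p => p 0 * pd k g y p) x (fun j => iteratedDeriv j u x) * φ x)) =
          -φ x * ∑ k ∈ Finset.range (N + 1), (-1 : ℝ) ^ (k + 1) *
          Dop^[k] (fun y p => p 0 * pd k g y p) x (fun j => iteratedDeriv j u x) := by
          rw [Finset.mul_sum]
          exact Finset.sum_congr rfl fun k _ => by ring
        simpa [this] using h2
    _ = 0 := by simp

/-- Differentiation under the integral sign over a compact interval. -/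
lemma hasDerivAt_integral_of_continuousOn {Φ Φ' : ℝ → ℝ → ℝ} {δ a b : ℝ} (hδ : 0 < δ)
    (hle : a ≤ b) (hΦ : ∀ t ∈ Icc (-δ) δ, ContinuousOn (Φ t) (Icc a b))
    (hΦ' : ContinuousOn (Function.uncurry Φ') (Icc (-δ) δ ×ˢ Icc a b))
    (hd : ∀ t ∈ Icc (-δ) δ, ∀ x ∈ Icc a b, HasDerivAt (fun s => Φ s x) (Φ' t x) t) :
    HasDerivAt (fun t => ∫ x in a..b, Φ t x) (∫ x in a..b, Φ' 0 x) 0 := by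
  have hsub : uIoc a b ⊆ Icc a b := by
    rw [uIoc_of_le hle]
    exact Ioc_subset_Icc_self
  have h0 : Icc (-δ) δ ∈ 𝓝 (0 : ℝ) := Icc_mem_nhds (by linarith) hδ
  have hinteg : ∀ {f : ℝ → ℝ}, ContinuousOn f (Icc a b) →
      IntervalIntegrable f MeasureTheory.volume a b := fun hf =>
    (ContinuousOn.intervalIntegrable (by rwa [uIcc_of_le hle]))
  have hmeas : ∀ {f : ℝ → ℝ}, ContinuousOn f (Icc a b) →
      MeasureTheory.AEStronglyMeasurable f (MeasureTheory.volume.restrict (uIoc a b)) := fun hf =>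
    (hf.mono hsub).aestronglyMeasurable measurableSet_uIoc
  obtain ⟨C, hC⟩ := (isCompact_Icc.prod isCompact_Icc).exists_bound_of_continuousOn hΦ'
  have h0' : ContinuousOn (Φ' 0) (Icc a b) :=
    hΦ'.comp (f := fun x => ((0 : ℝ), x)) (by fun_prop) fun x hx => ⟨mem_of_mem_nhds h0, hx⟩
  refine (intervalIntegral.hasDerivAt_integral_of_dominated_loc_of_deriv_le
    (bound := fun _ => C) h0 ?_ (hinteg (hΦ 0 (mem_of_mem_nhds h0))) (hmeas h0') ?_
    (by simp) ?_).2
  · filter_upwards [h0] with t ht using hmeas (hΦ t ht)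
  · exact .of_forall fun x hx t ht => hC (t, x) ⟨ht, hsub hx⟩
  · exact .of_forall fun x hx t ht => hd t ht x (hsub hx)

lemma jet_add_const_mul {u w : ℝ → ℝ} (hu : ContDiff ℝ (⊤ : ℕ∞) u)
    (hw : ContDiff ℝ (⊤ : ℕ∞) w) (N : ℕ) (t x : ℝ) :
    jet N (fun y => u y + t * w y) x = jet N u x + t • jet N w x := by
  have hle : ∀ k : ℕ, ((k : ℕ∞) : WithTop ℕ∞) ≤ ((⊤ : ℕ∞) : WithTop ℕ∞) := fun k => by
    exact_mod_cast le_top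
  funext i
  simp only [jet, Pi.add_apply, Pi.smul_apply, smul_eq_mul]
  rw [iteratedDeriv_fun_add (hu.of_le (hle i)).contDiffAt
    ((contDiff_const.mul hw).of_le (hle i)).contDiffAt, iteratedDeriv_const_mul_field]

lemma exists_forall_add_mul_pos {u w : ℝ → ℝ} {a b : ℝ} (hu : ContinuousOn u (Icc a b))
    (hw : ContinuousOn w (Icc a b)) (hpos : ∀ x ∈ Icc a b, 0 < u x) :
    ∃ δ > 0, ∀ t ∈ Icc (-δ) δ, ∀ x ∈ Icc a b, 0 < u x + t * w x := by
  obtain ⟨c, hc, hcu⟩ := isCompact_Icc.exists_forall_le' hu hpos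
  obtain ⟨C, hC⟩ := isCompact_Icc.exists_bound_of_continuousOn hw
  refine ⟨c / (|C| + 1), by positivity, fun t ht x hx => ?_⟩
  have h1 : |t| * |w x| < c := by
    calc |t| * |w x| ≤ c / (|C| + 1) * |C| := by
          exact mul_le_mul (abs_le.2 ht) ((hC x hx).trans (le_abs_self C)) (abs_nonneg _)
            (by positivity)
      _ < c := by
          rw [div_mul_eq_mul_div, div_lt_iff₀ (by positivity)]
          nlinarith
  have h2 := neg_abs_le (t * w x)
  rw [abs_mul] at h2
  linarith [hcu x hx]

set_option maxHeartbeats 1000000 in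
/-- The derivative of `Represents.integral_mul_fderiv_eq_zero` with respect to the base
function, in the direction `w`. -/
lemma Represents.integral_snd_fderiv_eq_zero {X : Set ℝ} (hX : IsOpen X) {N : ℕ} {g : QFun}
    {F : ℝ × (Fin (N + 1) → ℝ) → ℝ} (h : Represents X N g F)
    (hL : ∀ x ∈ X, ∀ q : ℕ → ℝ, 0 < q 0 → Lop g x q = 0) {u v w : ℝ → ℝ}
    (hu : ContDiff ℝ (⊤ : ℕ∞) u) (hv : ContDiff ℝ (⊤ : ℕ∞) v) (hw : ContDiff ℝ (⊤ : ℕ∞) w)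
    {a b : ℝ} (hle : a ≤ b) (hab : Icc a b ⊆ X) (hpos : ∀ x ∈ Icc a b, 0 < u x)
    (hva : ∀ k, iteratedDeriv k v a = 0) (hvb : ∀ k, iteratedDeriv k v b = 0) :
    (∫ x in a..b, w x * fderiv ℝ F (x, jet N u x) (0, jet N v x)) +
      ∫ x in a..b, u x *
        fderiv ℝ (fderiv ℝ F) (x, jet N u x) (0, jet N w x) (0, jet N v x) = 0 := by
  obtain ⟨δ, hδ, hδpos⟩ :=
    exists_forall_add_mul_pos hu.continuous.continuousOn hw.continuous.continuousOn hpos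
  have hF' := h.contDiffOn_fderiv hX
  have hF'' : ContDiffOn ℝ (⊤ : ℕ∞) (fderiv ℝ (fderiv ℝ F)) (jetDomain X N) :=
    hF'.fderiv_of_isOpen (isOpen_jetDomain hX N) (by simp)
  have hju := continuous_jet hu N
  have hjv := continuous_jet hv N
  have hjw := continuous_jet hw N
  have hcu := hu.continuous
  have hcw := hw.continuous
  let p : ℝ × ℝ → ℝ × (Fin (N + 1) → ℝ) := fun z => (z.2, jet N u z.2 + z.1 • jet N w z.2)
  have hp : Continuous p := by fun_prop
  have hpm : MapsTo p (Icc (-δ) δ ×ˢ Icc a b) (jetDomain X N) := fun z hz =>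
    ⟨hab hz.2, by simpa [p, jet] using hδpos z.1 hz.1 z.2 hz.2⟩
  let A : ℝ × ℝ → ℝ := fun z => w z.2 * fderiv ℝ F (p z) (0, jet N v z.2)
  let B : ℝ × ℝ → ℝ := fun z => (u z.2 + z.1 * w z.2) *
    fderiv ℝ (fderiv ℝ F) (p z) (0, jet N w z.2) (0, jet N v z.2)
  have hC : ContinuousOn (fun z => fderiv ℝ F (p z) (0, jet N v z.2))
      (Icc (-δ) δ ×ˢ Icc a b) :=
    (hF'.continuousOn.comp hp.continuousOn hpm).clm_apply (by fun_prop)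
  have hA : ContinuousOn A (Icc (-δ) δ ×ˢ Icc a b) :=
    ContinuousOn.mul (by fun_prop) hC
  have hB : ContinuousOn B (Icc (-δ) δ ×ˢ Icc a b) :=
    ContinuousOn.mul (by fun_prop)
      (((hF''.continuousOn.comp hp.continuousOn hpm).clm_apply (by fun_prop)).clm_apply
        (by fun_prop))
  have hslice : ∀ {G : ℝ × ℝ → ℝ}, ContinuousOn G (Icc (-δ) δ ×ˢ Icc a b) →
      ∀ t ∈ Icc (-δ) δ, ContinuousOn (fun x => G (t, x)) (Icc a b) := fun hG t ht =>
    hG.comp (f := fun x => (t, x)) (by fun_prop) fun x hx => ⟨ht, hx⟩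
  have hder := hasDerivAt_integral_of_continuousOn
    (Φ := fun t x => (u x + t * w x) * fderiv ℝ F (p (t, x)) (0, jet N v x))
    (Φ' := fun t x => A (t, x) + B (t, x)) hδ hle
    (fun t ht => ContinuousOn.mul (by fun_prop) (hslice hC t ht)) (hA.add hB) (by
      intro t ht x hx
      have h1 : HasDerivAt (fun s => u x + s * w x) (w x) t := by
        simpa using ((hasDerivAt_id' t).mul_const (w x)).const_add (u x)
      have h2 : HasDerivAt (fun s => p (s, x)) (0, jet N w x) t := by
        refine (hasDerivAt_const t x).prodMk ?_
        simpa using ((hasDerivAt_id' t).smul_const (jet N w x)).const_add (jet N u x)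
      have h3 : HasFDerivAt (fderiv ℝ F) (fderiv ℝ (fderiv ℝ F) (p (t, x))) (p (t, x)) :=
        ((hF'.contDiffAt ((isOpen_jetDomain hX N).mem_nhds
          (hpm (x := (t, x)) ⟨ht, hx⟩))).differentiableAt (by simp)).hasFDerivAt
      have h4 := (h3.comp_hasDerivAt t h2).clm_apply
        (hasDerivAt_const t ((0 : ℝ), jet N v x))
      simpa [A, B] using! h1.mul h4)
  have hzero : (fun t => ∫ x in a..b,
      (u x + t * w x) * fderiv ℝ F (p (t, x)) (0, jet N v x)) =ᶠ[𝓝 0] fun _ => 0 := by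
    filter_upwards [Icc_mem_nhds (show -δ < 0 by linarith) hδ] with t ht
    have := h.integral_mul_fderiv_eq_zero hX hL (u := fun y => u y + t * w y)
      (hu.add (contDiff_const.mul hw)) hv hle hab (hδpos t ht) hva hvb
    simpa only [jet_add_const_mul hu hw] using this
  have h0 : (0 : ℝ) ∈ Icc (-δ) δ := ⟨by linarith, hδ.le⟩
  have hinteg : ∀ {G : ℝ × ℝ → ℝ}, ContinuousOn G (Icc (-δ) δ ×ˢ Icc a b) →
      IntervalIntegrable (fun x => G (0, x)) MeasureTheory.volume a b := fun hG =>
    ContinuousOn.intervalIntegrable (by rw [uIcc_of_le hle]; exact hslice hG 0 h0)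
  have hfin := hder.unique (hzero.hasDerivAt_iff.2 (hasDerivAt_const _ _))
  rw [intervalIntegral.integral_add (hinteg hA) (hinteg hB)] at hfin
  simpa [A, B, p] using hfin

/-- If `L g = 0`, the linearization of `g` is formally self-adjoint. -/
lemma Represents.integral_mul_fderiv_comm {X : Set ℝ} (hX : IsOpen X) {N : ℕ} {g : QFun}
    {F : ℝ × (Fin (N + 1) → ℝ) → ℝ} (h : Represents X N g F)
    (hL : ∀ x ∈ X, ∀ q : ℕ → ℝ, 0 < q 0 → Lop g x q = 0) {u v w : ℝ → ℝ}
    (hu : ContDiff ℝ (⊤ : ℕ∞) u) (hv : ContDiff ℝ (⊤ : ℕ∞) v) (hw : ContDiff ℝ (⊤ : ℕ∞) w)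
    {a b : ℝ} (hle : a ≤ b) (hab : Icc a b ⊆ X) (hpos : ∀ x ∈ Icc a b, 0 < u x)
    (hva : ∀ k, iteratedDeriv k v a = 0) (hvb : ∀ k, iteratedDeriv k v b = 0)
    (hwa : ∀ k, iteratedDeriv k w a = 0) (hwb : ∀ k, iteratedDeriv k w b = 0) :
    ∫ x in a..b, w x * fderiv ℝ F (x, jet N u x) (0, jet N v x) =
      ∫ x in a..b, v x * fderiv ℝ F (x, jet N u x) (0, jet N w x) := by
  have h1 := h.integral_snd_fderiv_eq_zero hX hL hu hv hw hle hab hpos hva hvb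
  have h2 := h.integral_snd_fderiv_eq_zero hX hL hu hw hv hle hab hpos hwa hwb
  have h3 : ∫ x in a..b, u x *
        fderiv ℝ (fderiv ℝ F) (x, jet N u x) (0, jet N w x) (0, jet N v x) =
      ∫ x in a..b, u x *
        fderiv ℝ (fderiv ℝ F) (x, jet N u x) (0, jet N v x) (0, jet N w x) := by
    refine intervalIntegral.integral_congr fun x hx => ?_
    rw [uIcc_of_le hle] at hx
    have hmem : (x, jet N u x) ∈ jetDomain X N := ⟨hab hx, by simpa [jet] using hpos x hx⟩
    have hsymm := (h.contDiffAt hX hmem).isSymmSndFDerivAt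
      (by rw [minSmoothness_of_isRCLikeNormedField]; exact WithTop.coe_le_coe.2 le_top)
    simp only [hsymm.eq (0, jet N w x) (0, jet N v x)]
  linarith

lemma exists_smooth_iteratedDeriv_eq (x : ℝ) (n : ℕ) (q : ℕ → ℝ) :
    ∃ u : ℝ → ℝ, ContDiff ℝ (⊤ : ℕ∞) u ∧ ∀ j ≤ n, iteratedDeriv j u x = q j := by
  induction n generalizing q with
  | zero => exact ⟨fun _ => q 0, contDiff_const, fun j hj => by simp [Nat.le_zero.1 hj]⟩
  | succ n ih =>
    obtain ⟨v, hv, hvq⟩ := ih fun j => q (j + 1)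
    have hd : ∀ y, HasDerivAt (fun y => q 0 + ∫ t in x..y, v t) (v y) y := fun y =>
      (hv.continuous.integral_hasStrictDerivAt x y).hasDerivAt.const_add _
    have hderiv : deriv (fun y => q 0 + ∫ t in x..y, v t) = v := funext fun y => (hd y).deriv
    refine ⟨_, contDiff_infty_iff_deriv.2
      ⟨fun y => (hd y).differentiableAt, by rwa [hderiv]⟩, fun j hj => ?_⟩
    cases j with
    | zero => simp
    | succ j => rw [iteratedDeriv_succ', hderiv, hvq j (by omega)]

lemma iteratedDeriv_eq_zero_of_eventuallyEq {φ : ℝ → ℝ} {x : ℝ} (h : φ =ᶠ[𝓝 x] 0) (k : ℕ) :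
    iteratedDeriv k φ x = 0 := by
  rw [h.iteratedDeriv_eq]
  simp

/-- If `L g = 0`, the derivative of `g` along the scaling field vanishes. -/
lemma Represents.fderiv_self_eq_zero {X : Set ℝ} (hX : IsOpen X) {N : ℕ} {g : QFun}
    {F : ℝ × (Fin (N + 1) → ℝ) → ℝ} (h : Represents X N g F)
    (hL : ∀ x ∈ X, ∀ q : ℕ → ℝ, 0 < q 0 → Lop g x q = 0) {x₀ : ℝ} (hx₀ : x₀ ∈ X)
    {q : ℕ → ℝ} (hq : 0 < q 0) :
    fderiv ℝ F (x₀, jetRestrict N q) (0, jetRestrict N q) = 0 := by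
  obtain ⟨u, hu, huq⟩ := exists_smooth_iteratedDeriv_eq x₀ N q
  have hjet : jet N u x₀ = jetRestrict N q := funext fun i => huq i (by omega)
  have hux₀ : 0 < u x₀ := by
    have := huq 0 (Nat.zero_le _)
    rw [iteratedDeriv_zero] at this
    rwa [this]
  rw [← hjet]
  by_contra hne
  let E : ℝ → ℝ := fun x => fderiv ℝ F (x, jet N u x) (0, jet N u x)
  have hju := continuous_jet hu N
  have hEc : ∀ x ∈ X, 0 < u x → ContinuousAt E x := fun x hx hux => by
    have hmem : (x, jet N u x) ∈ jetDomain X N := ⟨hx, by simpa [jet] using hux⟩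
    have h1 : ContinuousAt (fderiv ℝ F) (x, jet N u x) :=
      (h.contDiffOn_fderiv hX).continuousOn.continuousAt
        ((isOpen_jetDomain hX N).mem_nhds hmem)
    have h2 : ContinuousAt (fun y => fderiv ℝ F (y, jet N u y)) x :=
      ContinuousAt.comp (f := fun y => (y, jet N u y)) h1 (by fun_prop)
    exact h2.clm_apply (by fun_prop)
  have hEpos : ∀ᶠ x in 𝓝 x₀, 0 < E x₀ * E x :=
    ((hEc x₀ hx₀ hux₀).const_mul (E x₀)).eventually (lt_mem_nhds (mul_self_pos.2 hne))
  obtain ⟨ε, hε, hball⟩ := Metric.eventually_nhds_iff.1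
    ((hX.eventually_mem hx₀).and ((hu.continuous.continuousAt.eventually (lt_mem_nhds hux₀)).and hEpos))
  obtain ⟨r, hr, hrε⟩ : ∃ r > 0, 5 * r < ε := ⟨ε / 6, by positivity, by linarith⟩
  have hgood : ∀ x ∈ Icc (x₀ - 5 * r) (x₀ + 5 * r), x ∈ X ∧ 0 < u x ∧ 0 < E x₀ * E x :=
    fun x hx => hball (by
      rw [Real.dist_eq, abs_lt]
      constructor <;> linarith [hx.1, hx.2])
  let v : ContDiffBump x₀ := ⟨r, 2 * r, hr, by linarith⟩
  let ψ : ContDiffBump x₀ := ⟨3 * r, 4 * r, by linarith, by linarith⟩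
  have hvs : ContDiff ℝ (⊤ : ℕ∞) v := v.contDiff
  have hws : ContDiff ℝ (⊤ : ℕ∞) fun x => ψ x * u x := ψ.contDiff.mul hu
  have hv0 : ∀ x, 2 * r < |x - x₀| → ∀ k, iteratedDeriv k v x = 0 := fun x hx =>
    iteratedDeriv_eq_zero_of_eventuallyEq <| by
      filter_upwards [(show Continuous fun y : ℝ => |y - x₀| by fun_prop).continuousAt.eventually
        (lt_mem_nhds hx)] with y hy
      exact v.zero_of_le_dist (by rw [Real.dist_eq]; exact hy.le)
  have hw0 : ∀ x, 4 * r < |x - x₀| → ∀ k, iteratedDeriv k (fun y => ψ y * u y) x = 0 :=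
    fun x hx => iteratedDeriv_eq_zero_of_eventuallyEq <| by
      filter_upwards [(show Continuous fun y : ℝ => |y - x₀| by fun_prop).continuousAt.eventually
        (lt_mem_nhds hx)] with y hy
      simp [ψ.zero_of_le_dist (x := y) (by rw [Real.dist_eq]; exact hy.le)]
  have hw1 : ∀ x, |x - x₀| < 3 * r → (fun y => ψ y * u y) =ᶠ[𝓝 x] u := fun x hx => by
    filter_upwards [(show Continuous fun y : ℝ => |y - x₀| by fun_prop).continuousAt.eventually
        (gt_mem_nhds hx)] with y hy
    simp [ψ.one_of_mem_closedBall (x := y)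
      (by rw [Metric.mem_closedBall, Real.dist_eq]; exact hy.le)]
  have ha : |x₀ - 5 * r - x₀| = 5 * r := by
    rw [show x₀ - 5 * r - x₀ = -(5 * r) by ring, abs_neg, abs_of_pos (by linarith)]
  have hb : |x₀ + 5 * r - x₀| = 5 * r := by
    rw [show x₀ + 5 * r - x₀ = 5 * r by ring, abs_of_pos (by linarith)]
  have hle : x₀ - 5 * r ≤ x₀ + 5 * r := by linarith
  have hab : Icc (x₀ - 5 * r) (x₀ + 5 * r) ⊆ X := fun x hx => (hgood x hx).1
  have hpos : ∀ x ∈ Icc (x₀ - 5 * r) (x₀ + 5 * r), 0 < u x := fun x hx => (hgood x hx).2.1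
  have hva := hv0 (x₀ - 5 * r) (by linarith)
  have hvb := hv0 (x₀ + 5 * r) (by linarith)
  have hcomm := h.integral_mul_fderiv_comm hX hL hu hvs hws hle hab hpos hva hvb
    (hw0 _ (by linarith)) (hw0 _ (by linarith))
  have hfirst := h.integral_mul_fderiv_eq_zero hX hL hu hvs hle hab hpos hva hvb
  have hleft : ∀ x, ψ x * u x * fderiv ℝ F (x, jet N u x) (0, jet N v x) =
      u x * fderiv ℝ F (x, jet N u x) (0, jet N v x) := fun x => by
    by_cases hx : |x - x₀| < 3 * r
    · rw [(hw1 x hx).eq_of_nhds]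
    · have : jet N v x = 0 := funext fun i => hv0 x (by linarith) i
      rw [this, Prod.mk_zero_zero, map_zero, mul_zero, mul_zero]
  have hright : ∀ x, v x * fderiv ℝ F (x, jet N u x) (0, jet N (fun y => ψ y * u y) x) =
      v x * E x := fun x => by
    by_cases hx : |x - x₀| < 3 * r
    · have : jet N (fun y => ψ y * u y) x = jet N u x :=
        funext fun i => (hw1 x hx).iteratedDeriv_eq i
      rw [this]
    · rw [v.zero_of_le_dist (x := x) (by rw [Real.dist_eq]; change 2 * r ≤ _; linarith)]
      ring
  simp only [hleft, hright, hfirst] at hcomm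
  have hcont : ContinuousOn (fun x => v x * (E x₀ * E x)) (Icc (x₀ - 5 * r) (x₀ + 5 * r)) :=
    hvs.continuous.continuousOn.mul (continuousOn_const.mul fun x hx =>
      (hEc x (hab hx) (hpos x hx)).continuousWithinAt)
  have hstrict : 0 < ∫ x in (x₀ - 5 * r)..(x₀ + 5 * r), v x * (E x₀ * E x) := by
    refine intervalIntegral.integral_pos (by linarith) hcont (fun x hx => ?_)
      ⟨x₀, ⟨by linarith, by linarith⟩, ?_⟩
    · exact mul_nonneg v.nonneg (hgood x (Ioc_subset_Icc_self hx)).2.2.le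
    · rw [v.one_of_mem_closedBall (Metric.mem_closedBall_self hr.le), one_mul]
      exact mul_self_pos.2 hne
  have hscale : ∫ x in (x₀ - 5 * r)..(x₀ + 5 * r), v x * (E x₀ * E x) =
      E x₀ * ∫ x in (x₀ - 5 * r)..(x₀ + 5 * r), v x * E x := by
    rw [← intervalIntegral.integral_const_mul]
    exact intervalIntegral.integral_congr fun x _ => by ring
  rw [hscale, ← hcomm, mul_zero] at hstrict
  exact hstrict.false

/-- If `f` is a q-function with `L f = 0` identically, then
`f` is `0`-homogeneous. -/
theorem stmt8 (X : Set ℝ) (hX : IsOpenInterval X) (m : ℕ) (f : QFun)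
    (hf : IsQFunc X m f)
    (hL : ∀ x ∈ X, ∀ q : ℕ → ℝ, 0 < q 0 → Lop f x q = 0) :
    IsHomog X 0 f := by
  obtain ⟨F, hF, hfF⟩ := hf
  have h : Represents X m f F := ⟨hF, fun x _ q _ => hfF x q⟩
  intro x hx q hq l hl
  have hd : ∀ t ∈ Ioi (0 : ℝ), HasDerivAt (fun s => F (x, s • jetRestrict m q)) 0 t := by
    intro t ht
    have hmem : (x, t • jetRestrict m q) ∈ jetDomain X m := ⟨hx, mul_pos ht hq⟩
    have h1 : HasDerivAt (fun s => F (x, s • jetRestrict m q))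
        (fderiv ℝ F (x, t • jetRestrict m q) (0, jetRestrict m q)) t :=
      (h.hasFDerivAt hX.1 hmem).comp_hasDerivAt t ((hasDerivAt_const t x).prodMk
        (by simpa using (hasDerivAt_id' t).smul_const (jetRestrict m q)))
    have h2 : t * fderiv ℝ F (x, t • jetRestrict m q) (0, jetRestrict m q) = 0 := by
      rw [← smul_eq_mul, ← map_smul, Prod.smul_mk, smul_zero]
      exact h.fderiv_self_eq_zero hX.1 hL hx (q := fun j => t * q j) (mul_pos ht hq)
    rwa [(mul_eq_zero.1 h2).resolve_left (ne_of_gt ht)] at h1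
  have hconst := isOpen_Ioi.is_const_of_deriv_eq_zero isPreconnected_Ioi
    (fun t ht => (hd t ht).differentiableAt.differentiableWithinAt)
    (fun t ht => (hd t ht).deriv) (mem_Ioi.2 hl) (mem_Ioi.2 one_pos)
  rw [Real.rpow_zero, one_mul, hfF, hfF]
  simpa using! hconst

end
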